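/- There is no cyclic sequence I₀, I₁, ..., I_{t−1} (t ≥ 3) of nonempty compact intervals in ℝ such that, for all indices i taken modulo t: (a) I_i ∩ I_{i+1} ≠ ∅, (b) I_i is contained neither in I_{i−1} nor in I_{i+1}, and (c) I_{i−1} ∩ I_{i+1} = ∅. -/

import Mathlib

/-- There is no cyclic sequence `I₀, …, I_{t-1}` (`t ≥ 3`) of nonempty compact
intervals in `ℝ` such that (indices mod `t`): (a) consecutive intervals meet,
(b) no interval is contained in one of its neighbours, and (c) intervals at
distance two are disjoint. -/
theorem no_cyclic_interval_sequence :
    ¬ ∃ (t : ℕ) (u v : ZMod t → ℝ), 3 ≤ t ∧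
      (∀ i, u i ≤ v i) ∧
      (∀ i, (Set.Icc (u i) (v i) ∩ Set.Icc (u (i + 1)) (v (i + 1))).Nonempty) ∧
      (∀ i, ¬ Set.Icc (u i) (v i) ⊆ Set.Icc (u (i - 1)) (v (i - 1)) ∧
            ¬ Set.Icc (u i) (v i) ⊆ Set.Icc (u (i + 1)) (v (i + 1))) ∧
      (∀ i, Set.Icc (u (i - 1)) (v (i - 1)) ∩ Set.Icc (u (i + 1)) (v (i + 1)) = ∅) := by
  rintro ⟨t, u, v, ht, -, hmeet, hsub, hdisj⟩
  have : NeZero t := ⟨by omega⟩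
  obtain ⟨i, hi⟩ := Finite.exists_min u
  -- both neighbours of an interval with least left endpoint contain its right endpoint
  have key : ∀ j, (Set.Icc (u i) (v i) ∩ Set.Icc (u j) (v j)).Nonempty →
      ¬ Set.Icc (u j) (v j) ⊆ Set.Icc (u i) (v i) → v i ∈ Set.Icc (u j) (v j) := by
    rintro j ⟨x, hx, hx'⟩ hj
    refine ⟨hx'.1.trans hx.2, ?_⟩
    by_contra! h
    exact hj (Set.Icc_subset_Icc (hi j) h.le)
  have hprev : v i ∈ Set.Icc (u (i - 1)) (v (i - 1)) := by
    have h₁ := hmeet (i - 1)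
    have h₂ := (hsub (i - 1)).2
    rw [sub_add_cancel] at h₁ h₂
    exact key _ (Set.inter_comm _ _ ▸ h₁) h₂
  have hnext : v i ∈ Set.Icc (u (i + 1)) (v (i + 1)) := by
    have h₂ := (hsub (i + 1)).1
    rw [add_sub_cancel_right] at h₂
    exact key _ (hmeet i) h₂
  exact Set.eq_empty_iff_forall_notMem.mp (hdisj i) (v i) ⟨hprev, hnext⟩
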